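/- Let A ∈ ℋⁿ and consider the Lyapunov transformation L_A : ℋⁿ → ℋⁿ defined by L_A(X) = (AX + XA)/2. Then λ(|L_A(X)|) ≺_w λ(|A|)*λ(|X|) for all X ∈ ℋⁿ, and λ(|A|) is the least vector of L_A; in particular, λ(|A|) ≺_w q for every q ∈ (ℝⁿ₊)↓ satisfying λ(|L_A(X)|) ≺_w q*λ(|X|) for all X ∈ ℋⁿ. -/

import Mathlib

open Matrix
open scoped ComplexOrder

/-- Sum of the `k` largest entries of `p` (as a supremum of sums over `k`-subsets). -/
noncomputable def sumLargest {n : ℕ} (p : Fin n → ℝ) (k : ℕ) : ℝ :=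
  sSup ((fun A : Finset (Fin n) => ∑ i ∈ A, p i) '' {A : Finset (Fin n) | A.card = k})

/-- `p` is weakly majorized by `q`. -/
def WeakMaj {n : ℕ} (p q : Fin n → ℝ) : Prop :=
  ∀ k : ℕ, 1 ≤ k → k ≤ n → sumLargest p k ≤ sumLargest q k

/-- `p` is majorized by `q`. -/
def Maj {n : ℕ} (p q : Fin n → ℝ) : Prop :=
  WeakMaj p q ∧ ∑ i, p i = ∑ i, q i

/-- `p` has nonnegative entries arranged in decreasing order. -/
def DecrNonneg {n : ℕ} (p : Fin n → ℝ) : Prop :=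
  Antitone p ∧ ∀ i, 0 ≤ p i

/-- The decreasing rearrangement of a vector. -/
noncomputable def decrRearrange {n : ℕ} (p : Fin n → ℝ) : Fin n → ℝ :=
  fun i => p (Tuple.sort p (Fin.rev i))

/-- `x` is the supremum of `S` in the weak-majorization order (w-sup). -/
def IsWSup {n : ℕ} (S : Set (Fin n → ℝ)) (x : Fin n → ℝ) : Prop :=
  DecrNonneg x ∧ (∀ s ∈ S, WeakMaj s x) ∧
    ∀ p : Fin n → ℝ, (∀ i, 0 ≤ p i) → (∀ s ∈ S, WeakMaj s p) → WeakMaj x p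

/-- `x` is the infimum of `Q` in the weak-majorization order (w-inf). -/
def IsWInf {n : ℕ} (Q : Set (Fin n → ℝ)) (x : Fin n → ℝ) : Prop :=
  DecrNonneg x ∧ (∀ q ∈ Q, WeakMaj x q) ∧
    ∀ p : Fin n → ℝ, (∀ i, 0 ≤ p i) → (∀ q ∈ Q, WeakMaj p q) → WeakMaj p x

open Classical in
/-- The vector of eigenvalues of a Hermitian matrix, in decreasing order
(junk value `0` if the matrix is not Hermitian). -/
noncomputable def specVec {n : ℕ} (X : Matrix (Fin n) (Fin n) ℂ) : Fin n → ℝ :=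
  if h : X.IsHermitian then decrRearrange h.eigenvalues else 0

open Classical in
/-- `λ(|X|)`: the absolute values of the eigenvalues of a Hermitian matrix `X`,
in decreasing order. -/
noncomputable def absSpecVec {n : ℕ} (X : Matrix (Fin n) (Fin n) ℂ) : Fin n → ℝ :=
  if h : X.IsHermitian then decrRearrange (fun i => |h.eigenvalues i|) else 0

/-- The Jordan product `X ∘ Y = (XY + YX)/2`. -/
noncomputable def jmul {n : ℕ} (X Y : Matrix (Fin n) (Fin n) ℂ) : Matrix (Fin n) (Fin n) ℂ :=
  (2 : ℂ)⁻¹ • (X * Y + Y * X)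

/-- A nonzero (orthogonal) projection in `ℋⁿ`. -/
def IsProjection {n : ℕ} (P : Matrix (Fin n) (Fin n) ℂ) : Prop :=
  P.IsHermitian ∧ P * P = P ∧ P ≠ 0

/-- An involution in `ℋⁿ`: a Hermitian matrix with `ε² = I`. -/
def IsInvolution {n : ℕ} (ε : Matrix (Fin n) (Fin n) ℂ) : Prop :=
  ε.IsHermitian ∧ ε * ε = 1

/-- A positive map: maps positive semidefinite matrices to positive semidefinite matrices. -/
def PositiveMap {n : ℕ} (T : Matrix (Fin n) (Fin n) ℂ → Matrix (Fin n) (Fin n) ℂ) : Prop :=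
  ∀ X : Matrix (Fin n) (Fin n) ℂ, X.PosSemidef → (T X).PosSemidef

/-- `S` is the adjoint of `T` with respect to the trace inner product on `ℋⁿ`. -/
def IsAdjointOf {n : ℕ} (S T : Matrix (Fin n) (Fin n) ℂ → Matrix (Fin n) (Fin n) ℂ) : Prop :=
  ∀ X Y : Matrix (Fin n) (Fin n) ℂ, X.IsHermitian → Y.IsHermitian →
    Matrix.trace (T X * Y) = Matrix.trace (X * S Y)

/-- `q` is the least vector of `T`: `λ(|T(X)|) ≺_w q * λ(|X|)` for all Hermitian `X`,
and `q ≺_w q'` for any other `q' ∈ (ℝⁿ₊)↓` with the same property. -/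
def IsLeastVector {n : ℕ} (T : Matrix (Fin n) (Fin n) ℂ → Matrix (Fin n) (Fin n) ℂ)
    (q : Fin n → ℝ) : Prop :=
  DecrNonneg q ∧
  (∀ X : Matrix (Fin n) (Fin n) ℂ, X.IsHermitian →
    WeakMaj (absSpecVec (T X)) (q * absSpecVec X)) ∧
  ∀ q' : Fin n → ℝ, DecrNonneg q' →
    (∀ X : Matrix (Fin n) (Fin n) ℂ, X.IsHermitian →
      WeakMaj (absSpecVec (T X)) (q' * absSpecVec X)) → WeakMaj q q'

lemma sumLargest_of_antitone {n : ℕ} {p : Fin n → ℝ} (hp : Antitone p) {k : ℕ} (hk : 1 ≤ k)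
    (hkn : k ≤ n) : sumLargest p k = ∑ i : Fin n, if i.val < k then p i else 0 := by
  classical
  have hcard : (Finset.univ.filter fun i : Fin n => i.val < k).card = k := by
    simp [Fin.card_filter_val_lt, hkn]
  refine IsGreatest.csSup_eq ⟨⟨Finset.univ.filter fun i : Fin n => i.val < k, hcard, ?_⟩, ?_⟩
  · simp [Finset.sum_filter]
  · rintro _ ⟨S, hS, rfl⟩
    have hS : S.card = k := hS
    set c := p ⟨k - 1, by omega⟩ with hc
    have key : ∑ i : Fin n, (if i ∈ S then p i - c else 0) ≤
        ∑ i : Fin n, if i.val < k then p i - c else 0 := by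
      refine Finset.sum_le_sum fun i _ => ?_
      have h1 : i.val < k → c ≤ p i := fun h => hp (Fin.mk_le_mk.2 (by omega) : i ≤ ⟨k - 1, _⟩)
      have h2 : ¬ i.val < k → p i ≤ c := fun h => hp (Fin.mk_le_mk.2 (by omega) : ⟨k - 1, _⟩ ≤ i)
      split_ifs with h h' h' <;> grind
    rw [← Finset.sum_filter, ← Finset.sum_filter, Finset.sum_sub_distrib,
      Finset.sum_sub_distrib] at key
    simp only [Finset.sum_const, hcard, Finset.filter_univ_mem, hS] at key
    rw [← Finset.sum_filter]
    linarith

lemma decrRearrange_antitone {n : ℕ} (p : Fin n → ℝ) : Antitone (decrRearrange p) :=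
  fun _ _ h => Tuple.monotone_sort p (Fin.rev_le_rev.2 h)

lemma absSpecVec_decrNonneg {n : ℕ} (X : Matrix (Fin n) (Fin n) ℂ) :
    DecrNonneg (absSpecVec X) := by
  unfold absSpecVec
  split_ifs with h
  · exact ⟨decrRearrange_antitone _, fun i => abs_nonneg _⟩
  · exact ⟨fun _ _ _ => le_rfl, fun _ => le_rfl⟩

lemma absSpecVec_one {n : ℕ} : absSpecVec (1 : Matrix (Fin n) (Fin n) ℂ) = 1 := by
  have h : (1 : Matrix (Fin n) (Fin n) ℂ).IsHermitian := isHermitian_one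
  have he (i : Fin n) : h.eigenvalues i = 1 := by
    have hi : h.eigenvalues i ∈ spectrum ℝ (1 : Matrix (Fin n) (Fin n) ℂ) :=
      h.spectrum_real_eq_range_eigenvalues ▸ Set.mem_range_self i
    have : Nonempty (Fin n) := ⟨i⟩
    simpa [spectrum.one_eq] using hi
  rw [absSpecVec, dif_pos h]
  funext i
  simp [decrRearrange, he]

/-- A singular value decomposition of a Hermitian matrix. -/
lemma exists_unitary_mul_absSpecVec_mul {n : ℕ} {X : Matrix (Fin n) (Fin n) ℂ}
    (hX : X.IsHermitian) : ∃ U ∈ unitaryGroup (Fin n) ℂ, ∃ V ∈ unitaryGroup (Fin n) ℂ,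
      X = U * diagonal (fun i => (absSpecVec X i : ℂ)) * V := by
  set σ : Equiv.Perm (Fin n) := Fin.revPerm.trans (Tuple.sort fun i => |hX.eigenvalues i|)
  set W : Matrix (Fin n) (Fin n) ℂ := (hX.eigenvectorUnitary : Matrix (Fin n) (Fin n) ℂ)
  have hWu : W ∈ unitaryGroup (Fin n) ℂ := hX.eigenvectorUnitary.2
  have hspec : X = W * diagonal (fun i => (hX.eigenvalues i : ℂ)) * Wᴴ := by
    conv_lhs => rw [hX.spectral_theorem]
    rfl
  set U := W.submatrix id σ
  set s : Fin n → ℂ := fun i => if hX.eigenvalues (σ i) < 0 then -1 else 1 with hs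
  have hU : U ∈ unitaryGroup (Fin n) ℂ := by
    rw [mem_unitaryGroup_iff']
    change (W.submatrix id σ)ᴴ * W.submatrix id σ = 1
    rw [conjTranspose_submatrix, ← submatrix_mul _ _ _ _ _ Function.bijective_id,
      ← star_eq_conjTranspose, mem_unitaryGroup_iff'.1 hWu, submatrix_one_equiv]
  have hsu : diagonal s ∈ unitaryGroup (Fin n) ℂ := by
    rw [mem_unitaryGroup_iff', star_eq_conjTranspose, diagonal_conjTranspose,
      diagonal_mul_diagonal, ← diagonal_one]
    congr 1
    funext i
    simp only [hs, Pi.star_apply]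
    split_ifs <;> simp
  refine ⟨U, hU, diagonal s * star U, mul_mem hsu (Unitary.star_mem hU), ?_⟩
  have habs (i : Fin n) : (absSpecVec X i : ℂ) * s i = hX.eigenvalues (σ i) := by
    have : absSpecVec X i = |hX.eigenvalues (σ i)| := by
      rw [absSpecVec, dif_pos hX]; rfl
    rw [this]
    simp only [hs]
    split_ifs with h
    · rw [abs_of_neg h]; push_cast; ring
    · rw [abs_of_nonneg (not_lt.1 h), mul_one]
  rw [← mul_assoc, mul_assoc U, diagonal_mul_diagonal]
  simp only [habs]
  have hd : diagonal (fun i => (hX.eigenvalues (σ i) : ℂ)) =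
      (diagonal fun i => (hX.eigenvalues i : ℂ)).submatrix σ σ :=
    (submatrix_diagonal_equiv (fun i => (hX.eigenvalues i : ℂ)) σ).symm
  rw [hd, star_eq_conjTranspose, conjTranspose_submatrix, submatrix_mul_equiv,
    submatrix_mul_equiv, submatrix_id_id]
  exact hspec

lemma exists_nonneg_sum_eq_of_antitone {n : ℕ} {f : Fin n → ℝ} (hf : DecrNonneg f) :
    ∃ c : Fin n → ℝ, (∀ r, 0 ≤ c r) ∧
      ∀ i, f i = ∑ r : Fin n, c r * if i.val < r.val + 1 then 1 else 0 := by
  set g : ℕ → ℝ := fun m => if h : m < n then f ⟨m, h⟩ else 0 with hg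
  refine ⟨fun r => g r - g (r + 1), fun r => ?_, fun i => ?_⟩
  · simp only [hg, r.2, dif_pos, Fin.eta]
    split_ifs with h
    · exact sub_nonneg.2 (hf.1 (Fin.mk_le_mk.2 (Nat.le_succ _) : r ≤ ⟨r + 1, h⟩))
    · simpa using hf.2 r
  · rw [Fin.sum_univ_eq_sum_range
      (fun m => (g m - g (m + 1)) * if i.val < m + 1 then 1 else 0) n]
    have key (m : ℕ) : ∑ r ∈ Finset.range m, (g r - g (r + 1)) * (if i.val < r + 1 then 1 else 0)
        = if i.val < m then g i - g m else 0 := by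
      induction m with
      | zero => simp
      | succ m ih =>
        rw [Finset.sum_range_succ, ih]
        rcases lt_trichotomy i.val m with h | h | h
        · simp [h, h.trans (Nat.lt_succ_self m)]
        · simp [h]
        · simp [not_lt.2 h.le, not_lt.2 (Nat.succ_le_of_lt h)]
    rw [key, if_pos i.2]
    simp [hg]

/-- The orthogonal projection onto the span of the first `a` standard basis vectors. -/
noncomputable def initialProj (n a : ℕ) : Matrix (Fin n) (Fin n) ℂ :=
  diagonal fun i => if i.val < a then 1 else 0

/-- Trace bounds extend from initial projections to nonnegative decreasing diagonals. -/
lemma norm_trace_diagonal_mul_le {n : ℕ} {f : Fin n → ℝ} (hf : DecrNonneg f)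
    {M : Matrix (Fin n) (Fin n) ℂ} {w : Fin n → ℝ}
    (h : ∀ a, ‖trace (initialProj n a * M)‖ ≤ ∑ i : Fin n, (if i.val < a then 1 else 0) * w i) :
    ‖trace (diagonal (fun i => (f i : ℂ)) * M)‖ ≤ ∑ i, f i * w i := by
  obtain ⟨c, hc, hfc⟩ := exists_nonneg_sum_eq_of_antitone hf
  have hd : diagonal (fun i => (f i : ℂ)) = ∑ r : Fin n, (c r : ℂ) • initialProj n (r + 1) := by
    ext i j
    rw [Matrix.sum_apply]
    by_cases hij : i = j
    · subst hij
      simp only [initialProj, hfc i, diagonal_apply_eq, Matrix.smul_apply, smul_eq_mul]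
      push_cast
      exact Finset.sum_congr rfl fun r _ => by split_ifs <;> simp
    · simp [initialProj, hij]
  calc ‖trace (diagonal (fun i => (f i : ℂ)) * M)‖
      = ‖∑ r : Fin n, (c r : ℂ) * trace (initialProj n (r + 1) * M)‖ := by
        rw [hd, Finset.sum_mul, trace_sum]; simp
    _ ≤ ∑ r : Fin n, c r * ∑ i : Fin n, (if i.val < r.val + 1 then 1 else 0) * w i := by
        refine (norm_sum_le _ _).trans (Finset.sum_le_sum fun r _ => ?_)
        rw [norm_mul, Complex.norm_real, Real.norm_of_nonneg (hc r)]
        exact mul_le_mul_of_nonneg_left (h _) (hc r)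
    _ = ∑ i, f i * w i := by
        simp only [Finset.mul_sum]
        rw [Finset.sum_comm]
        refine Finset.sum_congr rfl fun i _ => ?_
        rw [hfc i, Finset.sum_mul]
        exact Finset.sum_congr rfl fun r _ => by ring

section L2OpNorm

open scoped Matrix.Norms.L2Operator

lemma norm_apply_le_l2_opNorm {n : ℕ} (M : Matrix (Fin n) (Fin n) ℂ) (i j : Fin n) :
    ‖M i j‖ ≤ ‖M‖ := by
  have h := l2_opNorm_mulVec M (EuclideanSpace.single j (1 : ℂ))
  have h' := (PiLp.norm_apply_le _ i).trans h
  simpa using h'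

lemma norm_initialProj_le (n a : ℕ) : ‖initialProj n a‖ ≤ 1 := by
  rw [initialProj, l2_opNorm_diagonal]
  refine (pi_norm_le_iff_of_nonneg zero_le_one).2 fun i => ?_
  split_ifs <;> simp

lemma l2_opNorm_le_one_of_mem_unitaryGroup {n : ℕ} {U : Matrix (Fin n) (Fin n) ℂ}
    (hU : U ∈ unitaryGroup (Fin n) ℂ) : ‖U‖ ≤ 1 := by
  nontriviality Matrix (Fin n) (Fin n) ℂ
  exact (CStarRing.norm_of_mem_unitary hU).le

lemma norm_trace_initialProj_mul_le {n : ℕ} (a : ℕ) {M : Matrix (Fin n) (Fin n) ℂ}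
    (hM : ‖M‖ ≤ 1) :
    ‖trace (initialProj n a * M)‖ ≤ ∑ i : Fin n, if i.val < a then 1 else 0 := by
  refine (norm_sum_le _ _).trans (Finset.sum_le_sum fun i _ => ?_)
  rw [diag_apply, initialProj, diagonal_mul]
  split_ifs
  · simpa using (norm_apply_le_l2_opNorm M i i).trans hM
  · simp

lemma norm_trace_three_initialProj_le {n : ℕ} {U V W : Matrix (Fin n) (Fin n) ℂ}
    (hU : U ∈ unitaryGroup (Fin n) ℂ) (hV : V ∈ unitaryGroup (Fin n) ℂ)
    (hW : W ∈ unitaryGroup (Fin n) ℂ) (a b c : ℕ) :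
    ‖trace (initialProj n a * (U * (initialProj n b * (V * (initialProj n c * W)))))‖ ≤
      ∑ i : Fin n, (if i.val < a then 1 else 0) *
        ((if i.val < b then 1 else 0) * (if i.val < c then 1 else 0)) := by
  have hmul {P Q : Matrix (Fin n) (Fin n) ℂ} (hP : ‖P‖ ≤ 1) (hQ : ‖Q‖ ≤ 1) : ‖P * Q‖ ≤ 1 :=
    (norm_mul_le _ _).trans (mul_le_one₀ hP (norm_nonneg _) hQ)
  have hU' := l2_opNorm_le_one_of_mem_unitaryGroup hU
  have hV' := l2_opNorm_le_one_of_mem_unitaryGroup hV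
  have hW' := l2_opNorm_le_one_of_mem_unitaryGroup hW
  have ha := norm_trace_initialProj_mul_le a
    (hmul hU' (hmul (norm_initialProj_le n b) (hmul hV' (hmul (norm_initialProj_le n c) hW'))))
  have hb := norm_trace_initialProj_mul_le b
    (hmul hV' (hmul (norm_initialProj_le n c) (hmul hW' (hmul (norm_initialProj_le n a) hU'))))
  have hc := norm_trace_initialProj_mul_le c
    (hmul hW' (hmul (norm_initialProj_le n a) (hmul hU' (hmul (norm_initialProj_le n b) hV'))))
  have hb_eq : trace (initialProj n b * (V * (initialProj n c * (W * (initialProj n a * U))))) =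
      trace (initialProj n a * (U * (initialProj n b * (V * (initialProj n c * W))))) := by
    rw [← mul_assoc (initialProj n a) U, trace_mul_comm (initialProj n a * U)]
    simp only [mul_assoc]
  have hc_eq : trace (initialProj n c * (W * (initialProj n a * (U * (initialProj n b * V))))) =
      trace (initialProj n a * (U * (initialProj n b * (V * (initialProj n c * W))))) := by
    rw [← mul_assoc (initialProj n c) W, trace_mul_comm]
    simp only [mul_assoc]
  rw [hb_eq] at hb
  rw [hc_eq] at hc
  have hle (m : ℕ) (hma : m ≤ a) (hmb : m ≤ b) (hmc : m ≤ c) :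
      (∑ i : Fin n, if i.val < m then (1 : ℝ) else 0) ≤
        ∑ i : Fin n, (if i.val < a then 1 else 0) *
          ((if i.val < b then 1 else 0) * (if i.val < c then 1 else 0)) := by
    refine Finset.sum_le_sum fun i _ => ?_
    by_cases h : i.val < m
    · simp [h, h.trans_le hma, h.trans_le hmb, h.trans_le hmc]
    · rw [if_neg h]; positivity
  rcases le_total a b with hab | hab
  · rcases le_total a c with hac | hac
    · exact ha.trans (hle a le_rfl hab hac)
    · exact hc.trans (hle c hac (hac.trans hab) le_rfl)
  · rcases le_total b c with hbc | hbc
    · exact hb.trans (hle b hab le_rfl hbc)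
    · exact hc.trans (hle c (hbc.trans hab) hbc le_rfl)

end L2OpNorm

/-- A von Neumann type trace inequality. -/
lemma norm_trace_initialProj_mul_diagonal_le {n : ℕ} {f g : Fin n → ℝ} (hf : DecrNonneg f)
    (hg : DecrNonneg g) {U V W : Matrix (Fin n) (Fin n) ℂ}
    (hU : U ∈ unitaryGroup (Fin n) ℂ) (hV : V ∈ unitaryGroup (Fin n) ℂ)
    (hW : W ∈ unitaryGroup (Fin n) ℂ) (k : ℕ) :
    ‖trace (diagonal (fun i => (f i : ℂ)) *
        (U * (diagonal (fun i => (g i : ℂ)) * (V * (initialProj n k * W)))))‖ ≤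
      ∑ i : Fin n, f i * (g i * if i.val < k then 1 else 0) := by
  refine norm_trace_diagonal_mul_le hf fun a => ?_
  have hcomm (D : Matrix (Fin n) (Fin n) ℂ) :
      trace (initialProj n a * (U * (D * (V * (initialProj n k * W))))) =
        trace (D * (V * (initialProj n k * (W * (initialProj n a * U))))) := by
    rw [← mul_assoc (initialProj n a) U, trace_mul_comm (initialProj n a * U)]
    simp only [mul_assoc]
  rw [hcomm]
  refine (norm_trace_diagonal_mul_le hg
    (w := fun i => (if i.val < k then 1 else 0) * if i.val < a then 1 else 0) fun b => ?_).trans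
      (le_of_eq (Finset.sum_congr rfl fun i _ => by ring))
  exact norm_trace_three_initialProj_le hV hW hU b k a

lemma norm_trace_initialProj_mul_mul_le {n : ℕ} {A X : Matrix (Fin n) (Fin n) ℂ}
    (hA : A.IsHermitian) (hX : X.IsHermitian) {P Q : Matrix (Fin n) (Fin n) ℂ}
    (hP : P ∈ unitaryGroup (Fin n) ℂ) (hQ : Q ∈ unitaryGroup (Fin n) ℂ) (k : ℕ) :
    ‖trace (initialProj n k * (P * (A * X) * Q))‖ ≤
      ∑ i : Fin n, absSpecVec A i * (absSpecVec X i * if i.val < k then 1 else 0) := by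
  obtain ⟨U, hU, V, hV, hAe⟩ := exists_unitary_mul_absSpecVec_mul hA
  obtain ⟨U', hU', V', hV', hXe⟩ := exists_unitary_mul_absSpecVec_mul hX
  have h := norm_trace_initialProj_mul_diagonal_le (absSpecVec_decrNonneg A)
    (absSpecVec_decrNonneg X) (mul_mem hV hU') (mul_mem hV' hQ) (mul_mem hP hU) k
  convert h using 2
  conv_lhs => rw [hAe, hXe]
  have : initialProj n k * (P * (U * diagonal (fun i => (absSpecVec A i : ℂ)) * V *
      (U' * diagonal (fun i => (absSpecVec X i : ℂ)) * V')) * Q) =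
      (initialProj n k * (P * U)) * (diagonal (fun i => (absSpecVec A i : ℂ)) *
        (V * U' * (diagonal (fun i => (absSpecVec X i : ℂ)) * (V' * Q)))) := by
    simp only [mul_assoc]
  rw [this, trace_mul_comm]
  simp only [mul_assoc]

lemma jmul_isHermitian {n : ℕ} {A X : Matrix (Fin n) (Fin n) ℂ} (hA : A.IsHermitian)
    (hX : X.IsHermitian) : (jmul A X).IsHermitian := by
  unfold Matrix.IsHermitian jmul
  rw [conjTranspose_smul, conjTranspose_add, conjTranspose_mul, conjTranspose_mul, hA.eq, hX.eq,
    add_comm]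
  simp

lemma jmul_one {n : ℕ} (A : Matrix (Fin n) (Fin n) ℂ) : jmul A 1 = A := by
  rw [jmul, mul_one, one_mul, ← two_smul ℂ, smul_smul]
  norm_num

lemma weakMaj_absSpecVec_jmul {n : ℕ} {A X : Matrix (Fin n) (Fin n) ℂ} (hA : A.IsHermitian)
    (hX : X.IsHermitian) : WeakMaj (absSpecVec (jmul A X)) (absSpecVec A * absSpecVec X) := by
  intro k hk hkn
  have dA := absSpecVec_decrNonneg A
  have dX := absSpecVec_decrNonneg X
  have hanti : Antitone (absSpecVec A * absSpecVec X) := fun i j hij =>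
    mul_le_mul (dA.1 hij) (dX.1 hij) (dX.2 j) (dA.2 i)
  rw [sumLargest_of_antitone (absSpecVec_decrNonneg _).1 hk hkn,
    sumLargest_of_antitone hanti hk hkn]
  obtain ⟨U, hU, V, hV, hY⟩ := exists_unitary_mul_absSpecVec_mul (jmul_isHermitian hA hX)
  have hdiag : star U * jmul A X * star V =
      diagonal (fun i => (absSpecVec (jmul A X) i : ℂ)) := by
    conv_lhs => rw [hY]
    rw [mul_assoc U, ← mul_assoc (star U), mem_unitaryGroup_iff'.1 hU, one_mul, mul_assoc,
      mem_unitaryGroup_iff.1 hV, mul_one]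
  have hsum : trace (initialProj n k * (star U * jmul A X * star V)) =
      ((∑ i : Fin n, if i.val < k then absSpecVec (jmul A X) i else 0 : ℝ) : ℂ) := by
    rw [hdiag, initialProj, diagonal_mul_diagonal, trace_diagonal]
    push_cast
    exact Finset.sum_congr rfl fun i _ => by split_ifs <;> simp
  have hsplit : trace (initialProj n k * (star U * jmul A X * star V)) =
      (2 : ℂ)⁻¹ * (trace (initialProj n k * (star U * (A * X) * star V)) +
        trace (initialProj n k * (star U * (X * A) * star V))) := by
    simp only [jmul, mul_smul_comm, smul_mul_assoc, trace_smul, mul_add, add_mul, trace_add,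
      smul_eq_mul]
  have h1 := norm_trace_initialProj_mul_mul_le hA hX (Unitary.star_mem hU) (Unitary.star_mem hV) k
  have h2 := norm_trace_initialProj_mul_mul_le hX hA (Unitary.star_mem hU) (Unitary.star_mem hV) k
  have e1 : ∑ i : Fin n, absSpecVec A i * (absSpecVec X i * if i.val < k then 1 else 0) =
      ∑ i : Fin n, if i.val < k then (absSpecVec A * absSpecVec X) i else 0 :=
    Finset.sum_congr rfl fun i _ => by split_ifs <;> simp
  have e2 : ∑ i : Fin n, absSpecVec X i * (absSpecVec A i * if i.val < k then 1 else 0) =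
      ∑ i : Fin n, if i.val < k then (absSpecVec A * absSpecVec X) i else 0 :=
    Finset.sum_congr rfl fun i _ => by split_ifs <;> simp [mul_comm]
  rw [e1] at h1
  rw [e2] at h2
  calc ∑ i : Fin n, (if i.val < k then absSpecVec (jmul A X) i else 0)
      ≤ ‖((∑ i : Fin n, if i.val < k then absSpecVec (jmul A X) i else 0 : ℝ) : ℂ)‖ := by
        rw [Complex.norm_real]; exact Real.le_norm_self _
    _ = 2⁻¹ * ‖trace (initialProj n k * (star U * (A * X) * star V)) +
        trace (initialProj n k * (star U * (X * A) * star V))‖ := by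
        rw [← hsum, hsplit, norm_mul]; simp
    _ ≤ _ := by
        have := norm_add_le (trace (initialProj n k * (star U * (A * X) * star V)))
          (trace (initialProj n k * (star U * (X * A) * star V)))
        linarith

lemma weakMaj_absSpecVec_of_jmul {n : ℕ} {A : Matrix (Fin n) (Fin n) ℂ} {q : Fin n → ℝ}
    (h : ∀ X : Matrix (Fin n) (Fin n) ℂ, X.IsHermitian →
      WeakMaj (absSpecVec (jmul A X)) (q * absSpecVec X)) : WeakMaj (absSpecVec A) q := by
  simpa [jmul_one, absSpecVec_one] using h 1 isHermitian_one

theorem lyapunov_least_vector (n : ℕ) (A : Matrix (Fin n) (Fin n) ℂ) (hA : A.IsHermitian) :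
    (∀ X : Matrix (Fin n) (Fin n) ℂ, X.IsHermitian →
      WeakMaj (absSpecVec (jmul A X)) (absSpecVec A * absSpecVec X)) ∧
    IsLeastVector (fun X => jmul A X) (absSpecVec A) ∧
    ∀ q : Fin n → ℝ, DecrNonneg q →
      (∀ X : Matrix (Fin n) (Fin n) ℂ, X.IsHermitian →
        WeakMaj (absSpecVec (jmul A X)) (q * absSpecVec X)) →
      WeakMaj (absSpecVec A) q :=
  ⟨fun _ hX => weakMaj_absSpecVec_jmul hA hX,
    ⟨absSpecVec_decrNonneg A, fun _ hX => weakMaj_absSpecVec_jmul hA hX,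
      fun _ _ h => weakMaj_absSpecVec_of_jmul h⟩,
    fun _ _ h => weakMaj_absSpecVec_of_jmul h⟩
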